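/- Fix an integer n ≥ 1. There exists a constant c(n) > 0 depending only on n with the following property. Let h : ℝ → ℝ be C² with h'(s) ≤ (2/n)·h(s) for all s ∈ ℝ. Then for every R > 0, every smooth positive solution u of Δu + u h(ln u) = 0 on the ball B_{2R} ⊂ ℝⁿ satisfies |∇u|/u ≤ √(c(n))/R at every point of B_R. -/

import Mathlib

open Real Metric

/-- The Euclidean Laplacian: trace of the Hessian. -/
noncomputable def lap {n : ℕ} (f : EuclideanSpace ℝ (Fin n) → ℝ)
    (x : EuclideanSpace ℝ (Fin n)) : ℝ :=
  ∑ i : Fin n,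
    fderiv ℝ (fun y => fderiv ℝ f y (EuclideanSpace.single i 1)) x
      (EuclideanSpace.single i 1)

/-- The `i`-th partial derivative of a function on Euclidean space. -/
noncomputable def partialDeriv {n : ℕ} (i : Fin n) (f : EuclideanSpace ℝ (Fin n) → ℝ)
    (x : EuclideanSpace ℝ (Fin n)) : ℝ :=
  fderiv ℝ f x (EuclideanSpace.single i 1)

section PartialDeriv

open Filter Topology

variable {n : ℕ} {f g : EuclideanSpace ℝ (Fin n) → ℝ} {x : EuclideanSpace ℝ (Fin n)}

lemma lap_eq_sum_partialDeriv (f : EuclideanSpace ℝ (Fin n) → ℝ)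
    (x : EuclideanSpace ℝ (Fin n)) :
    lap f x = ∑ i, partialDeriv i (partialDeriv i f) x := rfl

lemma Filter.EventuallyEq.partialDeriv (h : f =ᶠ[𝓝 x] g) (i : Fin n) :
    partialDeriv i f =ᶠ[𝓝 x] partialDeriv i g := by
  filter_upwards [h.fderiv (𝕜 := ℝ)] with y hy
  simp only [_root_.partialDeriv, hy]

lemma ContDiffAt.partialDeriv (hf : ContDiffAt ℝ (⊤ : ℕ∞) f x) (i : Fin n) :
    ContDiffAt ℝ (⊤ : ℕ∞) (partialDeriv i f) x :=
  (hf.fderiv_right (m := (⊤ : ℕ∞)) (by simp)).clm_apply contDiffAt_const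

lemma ContDiffAt.differentiableAt_of_top (hf : ContDiffAt ℝ (⊤ : ℕ∞) f x) :
    DifferentiableAt ℝ f x :=
  hf.differentiableAt (by simp)

lemma ContDiffAt.eventually_differentiableAt (hf : ContDiffAt ℝ (⊤ : ℕ∞) f x) :
    ∀ᶠ y in 𝓝 x, DifferentiableAt ℝ f y := by
  filter_upwards [(hf.of_le (m := 1) (by exact_mod_cast le_top)).eventually (by simp)] with y hy
  exact hy.differentiableAt (by simp)

lemma partialDeriv_add (hf : DifferentiableAt ℝ f x) (hg : DifferentiableAt ℝ g x) (i : Fin n) :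
    partialDeriv i (fun y => f y + g y) x = partialDeriv i f x + partialDeriv i g x := by
  simp [partialDeriv, fderiv_fun_add hf hg]

lemma partialDeriv_mul (hf : DifferentiableAt ℝ f x) (hg : DifferentiableAt ℝ g x) (i : Fin n) :
    partialDeriv i (fun y => f y * g y) x
      = partialDeriv i f x * g x + f x * partialDeriv i g x := by
  simp [partialDeriv, fderiv_fun_mul hf hg]
  ring

lemma partialDeriv_sum {ι : Type*} {s : Finset ι} {F : ι → EuclideanSpace ℝ (Fin n) → ℝ}
    (hF : ∀ j ∈ s, DifferentiableAt ℝ (F j) x) (i : Fin n) :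
    partialDeriv i (fun y => ∑ j ∈ s, F j y) x = ∑ j ∈ s, partialDeriv i (F j) x := by
  simp [partialDeriv, fderiv_fun_sum hF]

lemma partialDeriv_comp {φ : ℝ → ℝ} (hφ : DifferentiableAt ℝ φ (f x))
    (hf : DifferentiableAt ℝ f x) (i : Fin n) :
    partialDeriv i (fun y => φ (f y)) x = deriv φ (f x) * partialDeriv i f x := by
  have h := (hφ.hasDerivAt.comp_hasFDerivAt x hf.hasFDerivAt).fderiv
  have h' : fderiv ℝ (fun y => φ (f y)) x = deriv φ (f x) • fderiv ℝ f x := h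
  simp [partialDeriv, h']

lemma partialDeriv_comm (hf : ContDiffAt ℝ (⊤ : ℕ∞) f x) (i j : Fin n) :
    partialDeriv i (partialDeriv j f) x = partialDeriv j (partialDeriv i f) x := by
  have hd : DifferentiableAt ℝ (fderiv ℝ f) x :=
    (hf.fderiv_right (m := (⊤ : ℕ∞)) (by simp)).differentiableAt (by simp)
  have key (a b : Fin n) : partialDeriv a (partialDeriv b f) x
      = fderiv ℝ (fderiv ℝ f) x (EuclideanSpace.single a 1) (EuclideanSpace.single b 1) := by
    unfold partialDeriv
    rw [fderiv_clm_apply hd (by fun_prop)]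
    simp
  rw [key, key]
  exact (hf.isSymmSndFDerivAt (by
    rw [minSmoothness_of_isRCLikeNormedField]
    exact WithTop.coe_le_coe.mpr (le_top : (2 : ℕ∞) ≤ ⊤))).eq _ _

lemma IsLocalMax.partialDeriv_eq_zero (h : IsLocalMax f x) (i : Fin n) :
    partialDeriv i f x = 0 := by
  simp [_root_.partialDeriv, h.fderiv_eq_zero]

/-- A function of one variable has nonpositive second derivative at a local maximum. -/
lemma IsLocalMax.deriv_deriv_nonpos {g : ℝ → ℝ} {t : ℝ} (h : IsLocalMax g t)
    (hc : ContinuousAt g t) : deriv (deriv g) t ≤ 0 := by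
  by_contra! hpos
  have hmin := isLocalMin_of_deriv_deriv_pos hpos h.deriv_eq_zero hc
  have hconst : g =ᶠ[𝓝 t] fun _ => g t := by
    filter_upwards [h, hmin] with s h₁ h₂ using le_antisymm h₁ h₂
  have : deriv (deriv g) t = 0 := by
    rw [hconst.deriv.deriv_eq]
    simp
  exact hpos.ne' this

lemma IsLocalMax.partialDeriv_partialDeriv_nonpos (h : IsLocalMax f x)
    (hf : ContDiffAt ℝ (⊤ : ℕ∞) f x) (i : Fin n) :
    partialDeriv i (partialDeriv i f) x ≤ 0 := by
  set e : EuclideanSpace ℝ (Fin n) := EuclideanSpace.single i 1 with he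
  have hline (t : ℝ) : HasDerivAt (fun s : ℝ => x + s • e) e t := by
    simpa using ((hasDerivAt_id t).smul_const e).const_add x
  have hderiv {p : EuclideanSpace ℝ (Fin n) → ℝ} {t : ℝ}
      (hp : DifferentiableAt ℝ p (x + t • e)) :
      deriv (fun s : ℝ => p (x + s • e)) t = _root_.partialDeriv i p (x + t • e) :=
    (hp.hasFDerivAt.comp_hasDerivAt t (hline t)).deriv
  have htend : Tendsto (fun s : ℝ => x + s • e) (𝓝 0) (𝓝 x) := by
    simpa using (hline 0).continuousAt.tendsto
  have hmax : IsLocalMax (fun s : ℝ => f (x + s • e)) 0 := by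
    have := htend.eventually h
    simpa [IsLocalMax, IsMaxFilter] using this
  have hev : deriv (fun s : ℝ => f (x + s • e)) =ᶠ[𝓝 0]
      fun s => _root_.partialDeriv i f (x + s • e) := by
    filter_upwards [htend.eventually hf.eventually_differentiableAt] with s hs
    exact hderiv hs
  have h0 : x + (0 : ℝ) • e = x := by simp
  have hcont : ContinuousAt (fun s : ℝ => f (x + s • e)) 0 :=
    ContinuousAt.comp (g := f) (by rw [h0]; exact hf.continuousAt) (hline 0).continuousAt
  have := hmax.deriv_deriv_nonpos hcont
  rw [hev.deriv_eq, hderiv (by rw [h0]; exact (hf.partialDeriv i).differentiableAt_of_top), h0]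
    at this
  exact this

/-- The squared length of the gradient. -/
noncomputable def gradSq {n : ℕ} (f : EuclideanSpace ℝ (Fin n) → ℝ)
    (x : EuclideanSpace ℝ (Fin n)) : ℝ :=
  ∑ i, partialDeriv i f x * partialDeriv i f x

lemma gradSq_nonneg (f : EuclideanSpace ℝ (Fin n) → ℝ) (x : EuclideanSpace ℝ (Fin n)) :
    0 ≤ gradSq f x :=
  Finset.sum_nonneg fun _ _ => mul_self_nonneg _

lemma gradSq_eq_norm_gradient_sq (f : EuclideanSpace ℝ (Fin n) → ℝ)
    (x : EuclideanSpace ℝ (Fin n)) : gradSq f x = ‖gradient f x‖ ^ 2 := by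
  rw [EuclideanSpace.real_norm_sq_eq]
  refine Finset.sum_congr rfl fun i _ => ?_
  have : (gradient f x) i = partialDeriv i f x := by
    have h := InnerProductSpace.toDual_symm_apply (𝕜 := ℝ)
      (x := EuclideanSpace.single i (1 : ℝ)) (y := fderiv ℝ f x)
    rw [EuclideanSpace.inner_single_right] at h
    simpa [gradient, partialDeriv] using h
  rw [this, sq]

lemma ContDiffAt.gradSq (hf : ContDiffAt ℝ (⊤ : ℕ∞) f x) :
    ContDiffAt ℝ (⊤ : ℕ∞) (gradSq f) x :=
  ContDiffAt.sum fun i _ => (hf.partialDeriv i).mul (hf.partialDeriv i)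

lemma partialDeriv_gradSq (hf : ContDiffAt ℝ (⊤ : ℕ∞) f x) (i : Fin n) :
    partialDeriv i (gradSq f) x
      = ∑ j, 2 * (partialDeriv j f x * partialDeriv i (partialDeriv j f) x) := by
  have hd (j : Fin n) := (hf.partialDeriv j).differentiableAt_of_top
  unfold gradSq
  rw [partialDeriv_sum fun j _ => (hd j).fun_mul (hd j)]
  refine Finset.sum_congr rfl fun j _ => ?_
  rw [partialDeriv_mul (hd j) (hd j)]
  ring

lemma partialDeriv_const_mul (c : ℝ) (hf : DifferentiableAt ℝ f x) (i : Fin n) :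
    partialDeriv i (fun y => c * f y) x = c * partialDeriv i f x := by
  simp [partialDeriv, fderiv_const_mul hf]

lemma lap_gradSq (hf : ∀ᶠ y in 𝓝 x, ContDiffAt ℝ (⊤ : ℕ∞) f y) :
    lap (gradSq f) x = 2 * ∑ i, ∑ j, partialDeriv i (partialDeriv j f) x ^ 2
      + 2 * ∑ j, partialDeriv j f x * partialDeriv j (lap f) x := by
  have hx := hf.self_of_nhds
  have hd (j : Fin n) := (hx.partialDeriv j).differentiableAt_of_top
  have hdd (i j : Fin n) := ((hx.partialDeriv j).partialDeriv i).differentiableAt_of_top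
  have hlap (j : Fin n) : partialDeriv j (lap f) x
      = ∑ i, partialDeriv i (partialDeriv i (partialDeriv j f)) x := by
    have : lap f = fun y => ∑ i, partialDeriv i (partialDeriv i f) y := rfl
    rw [this, partialDeriv_sum fun i _ => hdd i i]
    refine Finset.sum_congr rfl fun i _ => ?_
    rw [partialDeriv_comm (hx.partialDeriv i)]
    have hev : partialDeriv j (partialDeriv i f) =ᶠ[𝓝 x] partialDeriv i (partialDeriv j f) := by
      filter_upwards [hf] with y hy using partialDeriv_comm hy j i
    exact (hev.partialDeriv i).self_of_nhds
  have hrow (i : Fin n) : partialDeriv i (partialDeriv i (gradSq f)) x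
      = ∑ j, (2 * partialDeriv i (partialDeriv j f) x ^ 2
        + 2 * (partialDeriv j f x * partialDeriv i (partialDeriv i (partialDeriv j f)) x)) := by
    have hev : partialDeriv i (gradSq f) =ᶠ[𝓝 x]
        fun y => ∑ j, 2 * (partialDeriv j f y * partialDeriv i (partialDeriv j f) y) := by
      filter_upwards [hf] with y hy using partialDeriv_gradSq hy i
    rw [(hev.partialDeriv i).self_of_nhds,
      partialDeriv_sum fun j _ => ((hd j).fun_mul (hdd i j)).const_mul 2]
    refine Finset.sum_congr rfl fun j _ => ?_
    rw [partialDeriv_const_mul 2 ((hd j).fun_mul (hdd i j)), partialDeriv_mul (hd j) (hdd i j)]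
    ring
  rw [lap_eq_sum_partialDeriv, Finset.sum_congr rfl fun i _ => hrow i]
  simp only [hlap, Finset.sum_add_distrib, Finset.mul_sum]
  congr 1
  exact Finset.sum_comm

lemma lap_sq_le (f : EuclideanSpace ℝ (Fin n) → ℝ) (x : EuclideanSpace ℝ (Fin n)) :
    lap f x ^ 2 ≤ n * ∑ i, ∑ j, partialDeriv i (partialDeriv j f) x ^ 2 := by
  have h₁ := sq_sum_le_card_mul_sum_sq (s := (Finset.univ : Finset (Fin n)))
    (f := fun i => partialDeriv i (partialDeriv i f) x)
  rw [Finset.card_univ, Fintype.card_fin] at h₁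
  refine h₁.trans (mul_le_mul_of_nonneg_left ?_ n.cast_nonneg)
  refine Finset.sum_le_sum fun i _ => ?_
  exact Finset.single_le_sum (f := fun j => partialDeriv i (partialDeriv j f) x ^ 2)
    (fun j _ => sq_nonneg _) (Finset.mem_univ i)

/-- The Bochner inequality for `Δw + |∇w|² + h(w) = 0` with `h' ≤ (2 / n) h`. -/
lemma lap_gradSq_ge (hn : 1 ≤ n) {h : ℝ → ℝ} (hh : Differentiable ℝ h)
    (hh' : ∀ s, deriv h s ≤ (2 / (n : ℝ)) * h s)
    (hf : ∀ᶠ y in 𝓝 x, ContDiffAt ℝ (⊤ : ℕ∞) f y)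
    (heq : ∀ᶠ y in 𝓝 x, lap f y + gradSq f y + h (f y) = 0) :
    2 / (n : ℝ) * gradSq f x ^ 2
      - 2 * ∑ j, partialDeriv j f x * partialDeriv j (gradSq f) x ≤ lap (gradSq f) x := by
  have hx := hf.self_of_nhds
  have hn' : (0 : ℝ) < n := by exact_mod_cast hn
  have hF := gradSq_nonneg f x
  have hcomp : DifferentiableAt ℝ (fun y => h (f y)) x :=
    (hh (f x)).comp x hx.differentiableAt_of_top
  have hev : lap f =ᶠ[𝓝 x] fun y => (-1) * (gradSq f y + h (f y)) := by
    filter_upwards [heq] with y hy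
    linarith
  have hlap (j : Fin n) : partialDeriv j (lap f) x
      = -partialDeriv j (gradSq f) x - deriv h (f x) * partialDeriv j f x := by
    have hd := hx.gradSq.differentiableAt_of_top
    rw [(hev.partialDeriv j).self_of_nhds, partialDeriv_const_mul _ (hd.fun_add hcomp),
      partialDeriv_add hd hcomp, partialDeriv_comp (hh _) hx.differentiableAt_of_top]
    ring
  have hsum : ∑ j, partialDeriv j f x * partialDeriv j (lap f) x
      = -∑ j, partialDeriv j f x * partialDeriv j (gradSq f) x
        - deriv h (f x) * gradSq f x := by
    simp only [hlap, gradSq, Finset.mul_sum, ← Finset.sum_neg_distrib, ← Finset.sum_sub_distrib]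
    exact Finset.sum_congr rfl fun j _ => by ring
  rw [lap_gradSq hf, hsum]
  have hhess := lap_sq_le f x
  rw [hev.self_of_nhds] at hhess
  have hmul := mul_le_mul_of_nonneg_right (hh' (f x)) hF
  have hdiv : ((-1) * (gradSq f x + h (f x))) ^ 2 / n
      ≤ ∑ i, ∑ j, partialDeriv i (partialDeriv j f) x ^ 2 := by
    rw [div_le_iff₀' hn']
    exact hhess
  have hid : ((-1) * (gradSq f x + h (f x))) ^ 2 / n
      = gradSq f x ^ 2 / n + 2 / n * h (f x) * gradSq f x + h (f x) ^ 2 / n := by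
    ring
  have hsq : 0 ≤ h (f x) ^ 2 / n := by positivity
  have h2 : 2 / (n : ℝ) * gradSq f x ^ 2 = 2 * (gradSq f x ^ 2 / n) := by ring
  linarith

lemma partialDeriv_sub_norm_sq (a : ℝ) (i : Fin n) (x : EuclideanSpace ℝ (Fin n)) :
    partialDeriv i (fun y => a - ‖y‖ ^ 2) x = -2 * x i := by
  have h := ((hasStrictFDerivAt_norm_sq x).hasFDerivAt.const_sub a).fderiv
  simp only [partialDeriv, h]
  simp [EuclideanSpace.inner_single_right]

lemma partialDeriv_coord (i : Fin n) (c : ℝ) (x : EuclideanSpace ℝ (Fin n)) :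
    partialDeriv i (fun y => c * y i) x = c := by
  have h : HasFDerivAt (fun y : EuclideanSpace ℝ (Fin n) => y i)
      (EuclideanSpace.proj i : EuclideanSpace ℝ (Fin n) →L[ℝ] ℝ) x :=
    (EuclideanSpace.proj i : EuclideanSpace ℝ (Fin n) →L[ℝ] ℝ).hasFDerivAt
  rw [partialDeriv_const_mul c h.differentiableAt]
  simp [partialDeriv, h.fderiv]

/-- First and second order conditions at a local maximum of `(a - |x|²)² g`. -/
lemma cutoff_max_conditions {a : ℝ} (hg : ContDiffAt ℝ (⊤ : ℕ∞) g x) (hpos : 0 < a - ‖x‖ ^ 2)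
    (hmax : IsLocalMax (fun y => (a - ‖y‖ ^ 2) * (a - ‖y‖ ^ 2) * g y) x) :
    (∀ i, (a - ‖x‖ ^ 2) * partialDeriv i g x = 4 * x i * g x) ∧
      (a - ‖x‖ ^ 2) ^ 2 * lap g x
        ≤ (24 * ‖x‖ ^ 2 + 4 * n * (a - ‖x‖ ^ 2)) * g x := by
  set ψ : EuclideanSpace ℝ (Fin n) → ℝ := fun y => a - ‖y‖ ^ 2 with hψ
  have hψs : ContDiff ℝ (⊤ : ℕ∞) ψ := contDiff_const.sub (contDiff_norm_sq ℝ)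
  have hψd (y) : DifferentiableAt ℝ ψ y := hψs.contDiffAt.differentiableAt_of_top
  have hψ1 (i : Fin n) (y) : partialDeriv i ψ y = -2 * y i := partialDeriv_sub_norm_sq a i y
  have hfirst (i : Fin n) {y} (hy : DifferentiableAt ℝ g y) :
      partialDeriv i (fun y => ψ y * ψ y * g y) y
        = ψ y * ((-4) * y i * g y + ψ y * partialDeriv i g y) := by
    rw [partialDeriv_mul ((hψd y).fun_mul (hψd y)) hy, partialDeriv_mul (hψd y) (hψd y), hψ1]
    ring
  have hcoord (i : Fin n) : DifferentiableAt ℝ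
      (fun y : EuclideanSpace ℝ (Fin n) => (-4) * y i) x := by fun_prop
  have hsecond (i : Fin n) : partialDeriv i (partialDeriv i (fun y => ψ y * ψ y * g y)) x
      = (-2 * x i) * ((-4) * x i * g x + ψ x * partialDeriv i g x)
        + ψ x * ((-4) * g x + (-4) * x i * partialDeriv i g x
          + (-2 * x i * partialDeriv i g x + ψ x * partialDeriv i (partialDeriv i g) x)) := by
    have hev : partialDeriv i (fun y => ψ y * ψ y * g y) =ᶠ[𝓝 x]
        fun y => ψ y * ((-4) * y i * g y + ψ y * partialDeriv i g y) := by
      filter_upwards [hg.eventually_differentiableAt] with y hy using hfirst i hy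
    have hgd := hg.differentiableAt_of_top
    have hgi := (hg.partialDeriv i).differentiableAt_of_top
    rw [(hev.partialDeriv i).self_of_nhds,
      partialDeriv_mul (hψd x) (((hcoord i).fun_mul hgd).fun_add ((hψd x).fun_mul hgi)),
      partialDeriv_add ((hcoord i).fun_mul hgd) ((hψd x).fun_mul hgi),
      partialDeriv_mul (hcoord i) hgd, partialDeriv_mul (hψd x) hgi, hψ1, partialDeriv_coord]
  have hcrit (i : Fin n) : ψ x * partialDeriv i g x = 4 * x i * g x := by
    have h0 := hmax.partialDeriv_eq_zero i
    rw [hfirst i hg.differentiableAt_of_top] at h0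
    have := (mul_eq_zero.mp h0).resolve_left hpos.ne'
    linarith
  refine ⟨hcrit, ?_⟩
  have hterm (i : Fin n) : ψ x ^ 2 * partialDeriv i (partialDeriv i g) x
      ≤ (24 * x i ^ 2 + 4 * ψ x) * g x := by
    have h2 := hmax.partialDeriv_partialDeriv_nonpos
      ((hψs.contDiffAt.mul hψs.contDiffAt).mul hg) i
    rw [hsecond i] at h2
    linear_combination h2 + 8 * x i * hcrit i
  calc ψ x ^ 2 * lap g x
      = ∑ i, ψ x ^ 2 * partialDeriv i (partialDeriv i g) x := by
        rw [lap_eq_sum_partialDeriv, Finset.mul_sum]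
    _ ≤ ∑ i, (24 * x i ^ 2 + 4 * ψ x) * g x := Finset.sum_le_sum fun i _ => hterm i
    _ = (24 * ‖x‖ ^ 2 + 4 * n * ψ x) * g x := by
        rw [← Finset.sum_mul, Finset.sum_add_distrib, ← Finset.mul_sum,
          ← EuclideanSpace.real_norm_sq_eq]
        simp only [Finset.sum_const, Finset.card_univ, Fintype.card_fin, nsmul_eq_mul]
        ring

lemma cutoff_bound_at_max (hn : 1 ≤ n) {h : ℝ → ℝ} (hh : Differentiable ℝ h)
    (hh' : ∀ s, deriv h s ≤ (2 / (n : ℝ)) * h s) {ρ : ℝ} (hρ : 0 < ρ) (hxρ : ‖x‖ < ρ)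
    (hf : ∀ᶠ y in 𝓝 x, ContDiffAt ℝ (⊤ : ℕ∞) f y)
    (heq : ∀ᶠ y in 𝓝 x, lap f y + gradSq f y + h (f y) = 0)
    (hmax : IsLocalMax (fun y => (ρ ^ 2 - ‖y‖ ^ 2) * (ρ ^ 2 - ‖y‖ ^ 2) * gradSq f y) x) :
    (ρ ^ 2 - ‖x‖ ^ 2) * √(gradSq f x) ≤ 7 * n * ρ := by
  have hn' : (1 : ℝ) ≤ n := by exact_mod_cast hn
  have hr := norm_nonneg x
  have hpos : 0 < ρ ^ 2 - ‖x‖ ^ 2 := by nlinarith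
  obtain ⟨hcrit, hlap⟩ := cutoff_max_conditions hf.self_of_nhds.gradSq hpos hmax
  have hboch := lap_gradSq_ge hn hh hh' hf heq
  have hsum : (ρ ^ 2 - ‖x‖ ^ 2) * ∑ j, partialDeriv j f x * partialDeriv j (gradSq f) x
      = 4 * gradSq f x * ∑ j, partialDeriv j f x * x j := by
    simp only [Finset.mul_sum]
    refine Finset.sum_congr rfl fun j _ => ?_
    linear_combination partialDeriv j f x * hcrit j
  have hcs : ∑ j, partialDeriv j f x * x j ≤ √(gradSq f x) * ‖x‖ := by
    have := Real.sum_mul_le_sqrt_mul_sqrt Finset.univ (fun j => partialDeriv j f x) fun j => x j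
    rw [← EuclideanSpace.real_norm_sq_eq, Real.sqrt_sq hr] at this
    simpa only [gradSq, sq] using this
  have hF : gradSq f x = √(gradSq f x) ^ 2 := (Real.sq_sqrt (gradSq_nonneg f x)).symm
  have hp0 : 0 ≤ √(gradSq f x) := Real.sqrt_nonneg _
  generalize √(gradSq f x) = p at *
  generalize (∑ j, partialDeriv j f x * partialDeriv j (gradSq f) x) = A at *
  generalize (∑ j, partialDeriv j f x * x j) = B at *
  generalize lap (gradSq f) x = L at *
  rw [hF] at hcrit hlap hboch hsum
  rcases hp0.eq_or_lt with rfl | hp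
  · rw [mul_zero]
    positivity
  set ψ := ρ ^ 2 - ‖x‖ ^ 2 with hψ
  set t := ψ * p with ht
  have htpos : 0 < t := mul_pos hpos hp
  have hdiv : p ^ 2 * (2 / n * t ^ 2) ≤ p ^ 2 * (24 * ‖x‖ ^ 2 + 4 * n * ψ + 8 * t * ‖x‖) := by
    have h₁ := mul_le_mul_of_nonneg_left hboch (sq_nonneg ψ)
    have h₂ := mul_le_mul_of_nonneg_left hcs (by positivity : 0 ≤ 8 * ψ * p ^ 2)
    rw [ht]
    linear_combination h₁ + hlap + h₂ + 2 * ψ * hsum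
  have hdiv' := le_of_mul_le_mul_left hdiv (by positivity)
  have hbound : 24 * ‖x‖ ^ 2 + 4 * n * ψ + 8 * t * ‖x‖ ≤ 28 * n * ρ ^ 2 + 8 * t * ρ := by
    have h₁ : ‖x‖ ^ 2 ≤ ρ ^ 2 := by nlinarith
    have h₂ : 8 * t * ‖x‖ ≤ 8 * t * ρ := by gcongr
    have h₃ : 24 * ‖x‖ ^ 2 ≤ 24 * n * ρ ^ 2 := by nlinarith [sq_nonneg ρ]
    have h₄ : 4 * n * ψ ≤ 4 * n * ρ ^ 2 := by
      gcongr
      rw [hψ]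
      linarith [sq_nonneg ‖x‖]
    linarith
  have hmain : t ^ 2 ≤ 14 * (n * ρ) ^ 2 + 4 * (n * ρ) * t := by
    have h₁ := mul_le_mul_of_nonneg_left (hdiv'.trans hbound) (by positivity : (0 : ℝ) ≤ n / 2)
    have h₂ : (n : ℝ) / 2 * (2 / n * t ^ 2) = t ^ 2 := by field_simp
    rw [h₂] at h₁
    linarith
  have hnρ : 0 < n * ρ := by positivity
  by_contra! hlt
  nlinarith

lemma gradSq_sqrt_mul_le (hn : 1 ≤ n) {h : ℝ → ℝ} (hh : Differentiable ℝ h)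
    (hh' : ∀ s, deriv h s ≤ (2 / (n : ℝ)) * h s) {ρ r : ℝ} (hρ : 0 < ρ) (hr : ρ < r)
    (hf : ∀ y ∈ ball (0 : EuclideanSpace ℝ (Fin n)) r, ContDiffAt ℝ (⊤ : ℕ∞) f y)
    (heq : ∀ y ∈ ball (0 : EuclideanSpace ℝ (Fin n)) r, lap f y + gradSq f y + h (f y) = 0)
    (hx : x ∈ closedBall (0 : EuclideanSpace ℝ (Fin n)) ρ) :
    (ρ ^ 2 - ‖x‖ ^ 2) * √(gradSq f x) ≤ 7 * n * ρ := by
  set G : EuclideanSpace ℝ (Fin n) → ℝ :=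
    fun y => (ρ ^ 2 - ‖y‖ ^ 2) * (ρ ^ 2 - ‖y‖ ^ 2) * gradSq f y with hG
  have hsub := closedBall_subset_ball (x := (0 : EuclideanSpace ℝ (Fin n))) hr
  have hcont : ContinuousOn G (closedBall 0 ρ) := by
    have h₁ : ContinuousOn (gradSq f) (closedBall 0 ρ) := fun y hy =>
      (hf y (hsub hy)).gradSq.continuousAt.continuousWithinAt
    exact (by fun_prop : Continuous fun y : EuclideanSpace ℝ (Fin n) =>
      (ρ ^ 2 - ‖y‖ ^ 2) * (ρ ^ 2 - ‖y‖ ^ 2)).continuousOn.mul h₁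
  obtain ⟨z, hz, hmax⟩ := (isCompact_closedBall _ ρ).exists_isMaxOn ⟨x, hx⟩ hcont
  have hzρ : ‖z‖ ≤ ρ := by simpa using hz
  have hGsq (y : EuclideanSpace ℝ (Fin n)) :
      G y = ((ρ ^ 2 - ‖y‖ ^ 2) * √(gradSq f y)) ^ 2 := by
    rw [mul_pow, Real.sq_sqrt (gradSq_nonneg f y), sq (ρ ^ 2 - ‖y‖ ^ 2)]
  have hzbound : (ρ ^ 2 - ‖z‖ ^ 2) * √(gradSq f z) ≤ 7 * n * ρ := by
    rcases hzρ.eq_or_lt with hz' | hz'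
    · rw [hz', sub_self, zero_mul]
      positivity
    · have hU : ∀ᶠ y in 𝓝 z, y ∈ ball (0 : EuclideanSpace ℝ (Fin n)) r :=
        isOpen_ball.mem_nhds (hsub hz)
      refine cutoff_bound_at_max hn hh hh' hρ hz' (hU.mono hf) (hU.mono heq)
        (hmax.isLocalMax ?_)
      exact mem_of_superset (isOpen_ball.mem_nhds (by simpa using hz')) ball_subset_closedBall
  have hle : G x ≤ G z := hmax hx
  rw [hGsq, hGsq] at hle
  have hz0 : 0 ≤ (ρ ^ 2 - ‖z‖ ^ 2) * √(gradSq f z) :=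
    mul_nonneg (by nlinarith [norm_nonneg z]) (Real.sqrt_nonneg _)
  exact (le_of_sq_le_sq hle hz0).trans hzbound

lemma partialDeriv_log (hf : DifferentiableAt ℝ f x) (hpos : 0 < f x) (i : Fin n) :
    partialDeriv i (fun y => Real.log (f y)) x = (f x)⁻¹ * partialDeriv i f x := by
  rw [partialDeriv_comp (Real.differentiableAt_log hpos.ne') hf, Real.deriv_log]

lemma gradSq_log (hf : DifferentiableAt ℝ f x) (hpos : 0 < f x) :
    gradSq (fun y => Real.log (f y)) x = gradSq f x / f x ^ 2 := by
  simp only [gradSq, partialDeriv_log hf hpos, Finset.sum_div]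
  refine Finset.sum_congr rfl fun i _ => ?_
  field_simp

lemma lap_log (hf : ContDiffAt ℝ (⊤ : ℕ∞) f x) (hpos : 0 < f x) :
    lap (fun y => Real.log (f y)) x = lap f x / f x - gradSq (fun y => Real.log (f y)) x := by
  have hd := hf.differentiableAt_of_top
  rw [gradSq_log hd hpos]
  simp only [lap_eq_sum_partialDeriv, gradSq, Finset.sum_div, ← Finset.sum_sub_distrib]
  refine Finset.sum_congr rfl fun i _ => ?_
  have hev : partialDeriv i (fun y => Real.log (f y)) =ᶠ[𝓝 x]
      fun y => (f y)⁻¹ * partialDeriv i f y := by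
    filter_upwards [hf.eventually_differentiableAt, hf.continuousAt.eventually (lt_mem_nhds hpos)]
      with y hy hy' using partialDeriv_log hy hy' i
  rw [(hev.partialDeriv i).self_of_nhds,
    partialDeriv_mul (hd.fun_inv hpos.ne') (hf.partialDeriv i).differentiableAt_of_top,
    partialDeriv_comp (φ := fun s => s⁻¹) (differentiableAt_inv hpos.ne') hd, deriv_inv]
  field_simp
  ring

end PartialDeriv

/-- Corollary 1.5 (Euclidean case `K = 0`, `λ = 0`): gradient estimate for positive
solutions of `Δu + u h(ln u) = 0` when `h' ≤ (2/n) h`. -/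
theorem stmt_9 (n : ℕ) (hn : 1 ≤ n) :
    ∃ c : ℝ, 0 < c ∧
      ∀ h : ℝ → ℝ, ContDiff ℝ 2 h →
        (∀ s : ℝ, deriv h s ≤ (2 / (n : ℝ)) * h s) →
        ∀ R : ℝ, 0 < R →
          ∀ u : EuclideanSpace ℝ (Fin n) → ℝ,
            ContDiffOn ℝ (⊤ : ℕ∞) u (ball (0 : EuclideanSpace ℝ (Fin n)) (2 * R)) →
            (∀ x ∈ ball (0 : EuclideanSpace ℝ (Fin n)) (2 * R), 0 < u x) →
            (∀ x ∈ ball (0 : EuclideanSpace ℝ (Fin n)) (2 * R),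
              lap u x + u x * h (Real.log (u x)) = 0) →
            ∀ x ∈ ball (0 : EuclideanSpace ℝ (Fin n)) R,
              ‖gradient u x‖ / u x ≤ Real.sqrt c / R := by
  have hn' : (1 : ℝ) ≤ n := by exact_mod_cast hn
  refine ⟨(10 * n) ^ 2, by positivity, fun h hh hh' R hR u hu hpos heq x hx => ?_⟩
  have hu' : ∀ y ∈ ball (0 : EuclideanSpace ℝ (Fin n)) (2 * R), ContDiffAt ℝ (⊤ : ℕ∞) u y :=
    fun y hy => hu.contDiffAt (isOpen_ball.mem_nhds hy)
  have hxR : ‖x‖ < R := by simpa using hx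
  have hx2 : x ∈ ball (0 : EuclideanSpace ℝ (Fin n)) (2 * R) :=
    ball_subset_ball (by linarith) hx
  have hux := hpos x hx2
  have hbound := gradSq_sqrt_mul_le (f := fun y => Real.log (u y)) (x := x) (ρ := 3 / 2 * R)
    hn (hh.differentiable (by simp)) hh' (by positivity) (by linarith : 3 / 2 * R < 2 * R)
    (fun y hy => (hu' y hy).log (hpos y hy).ne')
    (fun y hy => by
      have hy0 := hpos y hy
      have hl : lap u y = -(u y * h (Real.log (u y))) := by linarith [heq y hy]
      rw [lap_log (hu' y hy) hy0, hl]
      field_simp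
      ring)
    (by simp only [mem_closedBall, dist_zero_right]; linarith)
  rw [gradSq_log (hu' x hx2).differentiableAt_of_top hux, gradSq_eq_norm_gradient_sq, ← div_pow,
    Real.sqrt_sq (by positivity)] at hbound
  rw [Real.sqrt_sq (by positivity), le_div_iff₀ hR]
  have hq : 0 ≤ ‖gradient u x‖ / u x := by positivity
  generalize ‖gradient u x‖ / u x = q at *
  have hψ : 5 / 4 * R ^ 2 ≤ (3 / 2 * R) ^ 2 - ‖x‖ ^ 2 := by nlinarith [norm_nonneg x]
  have h₁ : R * (5 / 4 * (q * R)) ≤ R * (21 / 2 * n) := by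
    linarith [mul_le_mul_of_nonneg_right hψ hq]
  have h₂ := le_of_mul_le_mul_left h₁ hR
  linarith
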